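/- Let w be a cyclically reduced word with [w] ∈ 𝒢. Then for every integer L, the number of classes [v] ∈ 𝒟(w) with L(v) = L equals C(L − L(w) + ρ(w) − 1, ρ(w) − 1). -/

import Mathlib

open scoped Classical

abbrev SL2Z := Matrix.SpecialLinearGroup (Fin 2) ℤ

def Amat : SL2Z := ⟨!![1, 2; 0, 1], by norm_num [Matrix.det_fin_two_of]⟩
def Bmat : SL2Z := ⟨!![1, 0; -2, 1], by norm_num [Matrix.det_fin_two_of]⟩
def Cmat : SL2Z := (Amat * Bmat)⁻¹

def Gamma : Subgroup SL2Z := Subgroup.closure {Amat, Bmat}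

/-- The real entry `i j` of a matrix in `SL₂(ℤ)`. -/
def entry (g : SL2Z) (i j : Fin 2) : ℝ := ((g : Matrix (Fin 2) (Fin 2) ℤ) i j : ℤ)

/-- The Möbius action of `SL₂(ℤ)` on the circle `ℝ ∪ {∞}`. -/
noncomputable def mobius (g : SL2Z) (p : OnePoint ℝ) : OnePoint ℝ :=
  Option.rec (motive := fun _ => OnePoint ℝ)
    (if entry g 1 0 = 0 then OnePoint.infty
     else OnePoint.some (entry g 0 0 / entry g 1 0))
    (fun x => if entry g 1 0 * x + entry g 1 1 = 0 then OnePoint.infty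
      else OnePoint.some ((entry g 0 0 * x + entry g 0 1) / (entry g 1 0 * x + entry g 1 1)))
    p

/-- The fixed-point set of `g` acting on the circle `ℝ ∪ {∞}`. -/
noncomputable def fixedSet (g : SL2Z) : Set (OnePoint ℝ) := {p | mobius g p = p}

/-- `g` is hyperbolic if `|trace g| > 2`. -/
def Hyperbolic (g : SL2Z) : Prop := 2 < |Matrix.trace (g : Matrix (Fin 2) (Fin 2) ℤ)|

/-- Two two-element subsets of the circle are linked if the two points of `Q` lie in
different connected components of the complement of `P`. -/
def Linked (P Q : Set (OnePoint ℝ)) : Prop :=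
  ∃ q₁ q₂ : OnePoint ℝ, q₁ ≠ q₂ ∧ Q = {q₁, q₂} ∧
    connectedComponentIn Pᶜ q₁ ≠ connectedComponentIn Pᶜ q₂

/-- `h` contributes to the count `s(v)`: `v` and `h * v * h⁻¹` are hyperbolic with
linked fixed-point sets. -/
def GoodConj (v h : Gamma) : Prop :=
  Hyperbolic (v : SL2Z) ∧ Hyperbolic ((h * v * h⁻¹ : Gamma) : SL2Z) ∧
    Linked (fixedSet (v : SL2Z)) (fixedSet ((h * v * h⁻¹ : Gamma) : SL2Z))

/-- Twice `s(v)`: the number of double cosets `⟨v⟩ h ⟨v⟩` in `Γ` such that `v` and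
`h * v * h⁻¹` are hyperbolic with linked fixed-point sets. -/
noncomputable def sTwo (v : Gamma) : ℕ :=
  Nat.card (Quot (fun h h' : {h : Gamma // GoodConj v h} =>
    ∃ m k : ℤ, (h' : Gamma) = v ^ m * (h : Gamma) * v ^ k))

/-- `v` is not a proper power in `Γ`. -/
def NotProperPower (v : Gamma) : Prop := ¬ ∃ u : Gamma, ∃ k : ℕ, 2 ≤ k ∧ v = u ^ k

/-- The self-intersection number `I(g) = n² s(v) + n - 1`, where `g = vⁿ` with `v` not a
proper power and `n ≥ 1`, and `s(v)` is half the number of good double cosets. -/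
noncomputable def Iγ (g : Gamma) : ℤ :=
  if h : ∃ p : Gamma × ℕ, 1 ≤ p.2 ∧ NotProperPower p.1 ∧ g = p.1 ^ p.2 then
    (h.choose.2 : ℤ) ^ 2 * ((sTwo h.choose.1 / 2 : ℕ) : ℤ) + (h.choose.2 : ℤ) - 1
  else 0
/-- The three-letter alphabet `{x, y, z}`. -/
inductive Letter | x | y | z
deriving DecidableEq

/-- The letter of `w` at cyclic position `i`. -/
def cget (w : List Letter) (i : ℕ) : Letter := w.getD (i % w.length) Letter.x

/-- `w` is cyclically reduced: nonempty, and any two cyclically consecutive letters differ. -/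
def CyclRed (w : List Letter) : Prop :=
  w ≠ [] ∧ ∀ i : ℕ, i < w.length → cget w i ≠ cget w (i + 1)

/-- The matrix assigned to a consecutive pair of letters:
`xy ↦ A`, `yx ↦ A⁻¹`, `yz ↦ B`, `zy ↦ B⁻¹`, `zx ↦ C`, `xz ↦ C⁻¹`. -/
def pairM : Letter → Letter → SL2Z
  | .x, .y => Amat
  | .y, .x => Amat⁻¹
  | .y, .z => Bmat
  | .z, .y => Bmat⁻¹
  | .z, .x => Cmat
  | .x, .z => Cmat⁻¹
  | _, _ => 1

/-- `φ(w)`: group the letters of `w` into consecutive pairs and multiply the matrices. -/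
def phiM : List Letter → SL2Z
  | [] => 1
  | [_] => 1
  | a :: b :: t => pairM a b * phiM t

lemma pairM_mem (a b : Letter) : pairM a b ∈ Gamma := by
  have hA : Amat ∈ Gamma := Subgroup.subset_closure (by simp)
  have hB : Bmat ∈ Gamma := Subgroup.subset_closure (by simp)
  have hC : Cmat ∈ Gamma := inv_mem (mul_mem hA hB)
  cases a <;> cases b <;>
    simp only [pairM] <;>
    first
      | exact hA | exact hB | exact hC
      | exact inv_mem hA | exact inv_mem hB | exact inv_mem hC
      | exact one_mem _

lemma phiM_mem : ∀ w : List Letter, phiM w ∈ Gamma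
  | [] => one_mem _
  | [_] => one_mem _
  | _ :: b :: t => mul_mem (pairM_mem _ b) (phiM_mem t)

/-- The self-intersection number of the word `w`. -/
noncomputable def Iw (w : List Letter) : ℤ := Iγ ⟨phiM w, phiM_mem w⟩

/-- The combinatorial length `L(w)` (half the number of letters). -/
def Lw (w : List Letter) : ℤ := (w.length : ℤ) / 2
/-- `w` is primitive: as a cyclic word it is not a `k`-fold concatenation of a
shorter word for any `k ≥ 2`. -/
def Primitive (w : List Letter) : Prop :=
  ¬ ∃ u : List Letter, ∃ k : ℕ, 2 ≤ k ∧ u.length < w.length ∧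
      ∃ j : ℕ, w.rotate j = (List.replicate k u).flatten

/-- `w` represents a class of `𝒢`: primitive, cyclically reduced, of even length at least 4. -/
def InG (w : List Letter) : Prop :=
  CyclRed w ∧ Primitive w ∧ 2 ∣ w.length ∧ 4 ≤ w.length

/-- Words representing classes of `𝒢`. -/
def GWord := {w : List Letter // InG w}

/-- `v` is obtained from `u`, or from its reversal, by a cyclic rotation through an
even number of places. -/
def WordEquiv (u v : List Letter) : Prop :=
  ∃ k : ℕ, 2 ∣ k ∧ (v = u.rotate k ∨ v = u.reverse.rotate k)

def GEquiv (u v : GWord) : Prop := WordEquiv u.1 v.1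

/-- The set `𝒢` of equivalence classes. -/
def GClass := Quot GEquiv

/-- The defect `δ(w) = I(w) - L(w)`. -/
noncomputable def deltaW (w : List Letter) : ℤ := Iw w - Lw w

/-- `N_δ(L)`: the number of classes `[w] ∈ 𝒢` with `L(w) = L` and `δ(w) = δ`. -/
noncomputable def Ncount (d L : ℤ) : ℕ :=
  Nat.card {c : GClass // ∃ w : GWord, Quot.mk GEquiv w = c ∧ Lw w.1 = L ∧ deltaW w.1 = d}
/-- The positions `i, i+1, …, i+len-1` (cyclically) form a run of `w`: a maximal cyclic
interval whose letters lie in a two-element subset of `{x, y, z}`. -/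
def RunAt (w : List Letter) (i len : ℕ) : Prop :=
  i < w.length ∧ 2 ≤ len ∧ len < w.length ∧
  (∃ T : Finset Letter, T.card = 2 ∧ ∀ j, j < len → cget w (i + j) ∈ T) ∧
  ¬ (∃ T : Finset Letter, T.card = 2 ∧ ∀ j, j < len + 1 → cget w (i + j) ∈ T) ∧
  ¬ (∃ T : Finset Letter, T.card = 2 ∧ ∀ j, j < len + 1 → cget w (i + w.length - 1 + j) ∈ T)

/-- The type of the run starting at position `i`: the two-element subset of letters it uses. -/
def runType (w : List Letter) (i : ℕ) : Finset Letter := {cget w i, cget w (i + 1)}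

/-- The expansion `w⁺[r]` of `w` at the run starting at position `i`: repeat the
first two letters of the run. -/
def expandAt (w : List Letter) (i : ℕ) : List Letter :=
  w.take i ++ [cget w i, cget w (i + 1)] ++ w.drop i

/-- The contraction `w⁻[r]` of `w` at the run starting at position `i`: delete the
first two letters of the run. -/
def contractAt (w : List Letter) (i : ℕ) : List Letter :=
  if i + 1 < w.length then w.take i ++ w.drop (i + 2)
  else (w.drop 1).dropLast

/-- The run at `(i, len)` is distinguished: strictly longer than every other run of the
same type. -/
def DistinguishedRun (w : List Letter) (i len : ℕ) : Prop :=
  RunAt w i len ∧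
    ∀ i' len', RunAt w i' len' → runType w i' = runType w i → i' ≠ i → len' < len

/-- The rank `ρ(w)`: the number of distinguished runs of `w`. -/
noncomputable def rank (w : List Letter) : ℕ :=
  Nat.card {p : ℕ × ℕ // DistinguishedRun w p.1 p.2}

/-- The motif condition: every run `r` with `ℓ(r) ≥ 4` admits another run `s` of the same
type with `ℓ(r) ≤ ℓ(s) + 2`. -/
def MotifCond (w : List Letter) : Prop :=
  ∀ i len, RunAt w i len → 4 ≤ len →
    ∃ i' len', RunAt w i' len' ∧ runType w i' = runType w i ∧ i' ≠ i ∧ len ≤ len' + 2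

/-- The binomial coefficient `C(n, k)` with the convention that it vanishes when `n` or `k`
is negative, except `C(-1, -1) = 1`. -/
def binC (n k : ℤ) : ℤ :=
  if n = -1 ∧ k = -1 then 1
  else if 0 ≤ n ∧ 0 ≤ k then (n.toNat.choose k.toNat : ℤ)
  else 0

/-- The word-level descendants of `w`: the smallest collection containing `w` and closed
under expansion at distinguished runs. -/
inductive Desc (w : List Letter) : List Letter → Prop
  | base : Desc w w
  | step (v : List Letter) (i len : ℕ) :
      Desc w v → DistinguishedRun v i len → Desc w (expandAt v i)

lemma cget_mod (w : List Letter) (k : ℕ) : cget w (k % w.length) = cget w k := by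
  simp [cget]

lemma cget_add_length (w : List Letter) (k : ℕ) : cget w (k + w.length) = cget w k := by
  simp [cget]

lemma length_expandAt (v : List Letter) (i : ℕ) : (expandAt v i).length = v.length + 2 := by
  simp only [expandAt, List.length_append, List.length_take, List.length_drop, List.length_cons,
    List.length_nil]
  omega

lemma cget_eq_getD {w : List Letter} {k : ℕ} (h : k < w.length) :
    cget w k = w.getD k Letter.x := by
  rw [cget, Nat.mod_eq_of_lt h]

lemma cget_expandAt_of_le {v : List Letter} {i k : ℕ} (hi : i < v.length) (hk : k ≤ i + 1) :
    cget (expandAt v i) k = cget v k := by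
  rw [cget_eq_getD (by rw [length_expandAt]; omega)]
  rcases lt_or_ge k i with h | h
  · rw [cget_eq_getD (h.trans hi)]
    simp [expandAt, List.getD_eq_getElem?_getD, List.getElem?_append, h, h.trans hi]
  · obtain rfl | rfl : k = i ∨ k = i + 1 := by omega
    · simp [expandAt, List.getD_eq_getElem?_getD, hi.le]
    · simp [expandAt, List.getD_eq_getElem?_getD, hi.le]

lemma cget_expandAt_add_two {v : List Letter} {i k : ℕ} (hi : i < v.length) (hk : i ≤ k)
    (hk' : k ≤ v.length + i + 1) : cget (expandAt v i) (k + 2) = cget v k := by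
  rcases lt_or_ge k v.length with h | h
  · rw [cget_eq_getD (by rw [length_expandAt]; omega), cget_eq_getD h]
    have h1 : k + 2 - i = (k - i) + 2 := by omega
    have h2 : ¬ k + 2 < i := by omega
    simp [expandAt, List.getD_eq_getElem?_getD, List.getElem?_append, hi.le, h1, h2]
    congr 2
    omega
  · obtain ⟨m, rfl⟩ := Nat.exists_eq_add_of_le' h
    rw [cget_add_length, add_assoc, ← length_expandAt v i, cget_add_length,
      cget_expandAt_of_le hi (by omega)]

/-- The letters at positions `k` and `k + 2` differ; for a cyclically reduced word this says that
the three letters from position `k` on are distinct. -/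
def Break (w : List Letter) (k : ℕ) : Prop := cget w k ≠ cget w (k + 2)

lemma break_add_length (w : List Letter) (k : ℕ) : Break w (k + w.length) ↔ Break w k := by
  rw [Break, Break, add_right_comm, cget_add_length, cget_add_length]

lemma break_expandAt_of_lt {v : List Letter} {i k : ℕ} (hi : i < v.length) (hk : k < i) :
    Break (expandAt v i) k ↔ Break v k := by
  rw [Break, Break, cget_expandAt_of_le hi (by omega), cget_expandAt_of_le hi (by omega)]

lemma break_expandAt_add_two {v : List Letter} {i k : ℕ} (hi : i < v.length) (hk : i ≤ k)
    (hk' : k < v.length + i) : Break (expandAt v i) (k + 2) ↔ Break v k := by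
  rw [Break, Break, cget_expandAt_add_two hi (by omega) (by omega),
    cget_expandAt_add_two hi (by omega) (by omega)]

lemma not_break_expandAt {v : List Letter} {i k : ℕ} (hi : i < v.length) (hk : i ≤ k)
    (hk' : k ≤ i + 1) : ¬ Break (expandAt v i) k := by
  rw [Break, not_not, cget_expandAt_of_le hi hk', cget_expandAt_add_two hi hk (by omega)]

lemma CyclRed.cget_ne {w : List Letter} (hw : CyclRed w) (k : ℕ) :
    cget w k ≠ cget w (k + 1) := by
  have := hw.2 (k % w.length) (Nat.mod_lt _ (List.length_pos_iff.2 hw.1))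
  rwa [cget_mod, ← cget_mod w (k % _ + 1), Nat.mod_add_mod, cget_mod] at this

lemma CyclRed.expandAt {v : List Letter} (hv : CyclRed v) {i : ℕ} (hi : i < v.length) :
    CyclRed (expandAt v i) := by
  have hlen := length_expandAt v i
  refine ⟨fun h => by simp [h] at hlen, fun k hk => ?_⟩
  rcases lt_trichotomy k (i + 1) with h | rfl | h
  · rw [cget_expandAt_of_le hi (by omega), cget_expandAt_of_le hi (by omega)]
    exact hv.cget_ne k
  · rw [cget_expandAt_of_le hi le_rfl, cget_expandAt_add_two hi le_rfl (by omega)]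
    exact (hv.cget_ne i).symm
  · obtain ⟨m, rfl⟩ := Nat.exists_eq_add_of_le' (show 2 ≤ k by omega)
    rw [add_right_comm, cget_expandAt_add_two hi (by omega) (by omega),
      cget_expandAt_add_two hi (by omega) (by omega)]
    exact hv.cget_ne m

lemma Finset.eq_pair_of_card_eq_two {T : Finset Letter} (hT : T.card = 2) {a b : Letter}
    (ha : a ∈ T) (hb : b ∈ T) (hab : a ≠ b) : {a, b} = T :=
  Finset.eq_of_subset_of_card_le (by simp [Finset.insert_subset_iff, ha, hb])
    (by rw [hT, Finset.card_pair hab])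

lemma CyclRed.card_runType {w : List Letter} (hw : CyclRed w) (i : ℕ) :
    (runType w i).card = 2 := Finset.card_pair (hw.cget_ne i)

/-- An interval of at least two letters lying in a two-element set has that set as its type. -/
lemma CyclRed.runType_eq {w : List Letter} (hw : CyclRed w) {T : Finset Letter} (hT : T.card = 2)
    {i l : ℕ} (hl : 2 ≤ l) (h : ∀ j < l, cget w (i + j) ∈ T) : runType w i = T :=
  Finset.eq_pair_of_card_eq_two hT (h 0 (by omega)) (h 1 (by omega)) (hw.cget_ne i)

lemma Break.notMem {w : List Letter} (hw : CyclRed w) {k : ℕ} (hb : Break w k)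
    {T : Finset Letter} (hT : T.card = 2) (h0 : cget w k ∈ T) (h1 : cget w (k + 1) ∈ T) :
    cget w (k + 2) ∉ T := by
  intro h2
  rw [← Finset.eq_pair_of_card_eq_two hT h0 h1 (hw.cget_ne k), Finset.mem_insert,
    Finset.mem_singleton] at h2
  exact h2.elim (fun h => hb h.symm) (fun h => hw.cget_ne (k + 1) h.symm)

lemma mem_runType_of_not_break {w : List Letter} {i m : ℕ} (h : ∀ k < m, ¬ Break w (i + k)) :
    ∀ j < m + 2, cget w (i + j) ∈ runType w i := by
  intro j
  induction j using Nat.strong_induction_on with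
  | _ j ih =>
    intro hj
    match j with
    | 0 => simp [runType]
    | 1 => simp [runType]
    | k + 2 =>
      have := h k (by omega)
      rw [Break, not_not] at this
      rw [← add_assoc, ← this]
      exact ih k (by omega) (by omega)

lemma forall_cget_mem {w : List Letter} (h0 : w ≠ []) {T : Finset Letter} {i : ℕ}
    (h : ∀ j < w.length, cget w (i + j) ∈ T) (k : ℕ) : cget w k ∈ T := by
  have hn := List.length_pos_iff.2 h0
  have := h ((k + (w.length - i % w.length)) % w.length) (Nat.mod_lt _ hn)
  rw [← cget_mod, Nat.add_mod_mod] at this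
  have e : i + (k + (w.length - i % w.length)) = k + w.length * (i / w.length + 1) := by
    have h1 := Nat.mod_lt i hn
    have h2 := Nat.mod_add_div i w.length
    rw [mul_add, mul_one]
    omega
  rwa [e, Nat.add_mul_mod_self_left, cget_mod] at this

/-- Runs are the intervals between consecutive breaks. -/
lemma runAt_iff {w : List Letter} (hw : CyclRed w) {i m : ℕ} :
    RunAt w i (m + 2) ↔ i < w.length ∧ (∀ k < m, ¬ Break w (i + k)) ∧ Break w (i + m) ∧
      Break w (i + w.length - 1) := by
  have hn := List.length_pos_iff.2 hw.1
  constructor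
  · rintro ⟨hi, -, -, ⟨T, hT, hin⟩, hright, hleft⟩
    obtain rfl := hw.runType_eq hT (by omega) hin
    have hno : ∀ k < m, ¬ Break w (i + k) := fun k hk hb =>
      hb.notMem hw hT (hin k (by omega)) (hin (k + 1) (by omega)) (hin (k + 2) (by omega))
    refine ⟨hi, hno, fun hb => ?_, fun hb => ?_⟩
    · refine hright ⟨_, hT, fun j hj => ?_⟩
      rcases Nat.lt_succ_iff_lt_or_eq.1 hj with h | rfl
      · exact hin j h
      · rw [← add_assoc, ← hb]
        exact hin m (by omega)
    · refine hleft ⟨_, hT, fun j hj => ?_⟩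
      match j with
      | 0 =>
        rw [add_zero, hb, show i + w.length - 1 + 2 = i + 1 + w.length by omega, cget_add_length]
        exact hin 1 (by omega)
      | j + 1 =>
        rw [show i + w.length - 1 + (j + 1) = i + j + w.length by omega, cget_add_length]
        exact hin j (by omega)
  · rintro ⟨hi, hno, hbr, hbl⟩
    have hin := mem_runType_of_not_break hno
    have hT := hw.card_runType i
    refine ⟨hi, by omega, ?_, ⟨_, hT, hin⟩, ?_, ?_⟩
    · by_contra! hlt
      have := forall_cget_mem hw.1 (fun j hj => hin j (by omega))
      exact hbr.notMem hw hT (this _) (this _) (this _)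
    · rintro ⟨T, hT, h⟩
      exact hbr.notMem hw hT (h m (by omega)) (h (m + 1) (by omega)) (h (m + 2) (by omega))
    · rintro ⟨T, hT, h⟩
      exact hbl.notMem hw hT (h 0 (by omega)) (h 1 (by omega)) (h 2 (by omega))

lemma RunAt.exists_eq {w : List Letter} {i l : ℕ} (h : RunAt w i l) : ∃ m, l = m + 2 :=
  Nat.exists_eq_add_of_le' h.2.1

lemma RunAt.length_unique {w : List Letter} {i l l' : ℕ} (h : RunAt w i l) (h' : RunAt w i l') :
    l = l' := by
  by_contra hne
  rcases lt_or_gt_of_ne hne with hlt | hlt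
  · obtain ⟨T, hT, hin⟩ := h'.2.2.2.1
    exact h.2.2.2.2.1 ⟨T, hT, fun j hj => hin j (by omega)⟩
  · obtain ⟨T, hT, hin⟩ := h.2.2.2.1
    exact h'.2.2.2.2.1 ⟨T, hT, fun j hj => hin j (by omega)⟩

/-- The position in `expandAt v i` of the run of `v` starting at `j`. -/
def shiftPos (i j : ℕ) : ℕ := if j ≤ i then j else j + 2

/-- The number of letters that the run starting at `j` gains when expanding at `i`. -/
def gain (i j : ℕ) : ℕ := if j = i then 2 else 0

lemma shiftPos_injective (i : ℕ) : Function.Injective (shiftPos i) := by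
  intro j k h
  unfold shiftPos at h
  split_ifs at h <;> omega

lemma runType_expandAt {v : List Letter} {i j : ℕ} (hi : i < v.length) (hj : j < v.length) :
    runType (expandAt v i) (shiftPos i j) = runType v j := by
  unfold runType shiftPos
  split_ifs with h
  · rw [cget_expandAt_of_le hi (by omega), cget_expandAt_of_le hi (by omega)]
  · rw [add_right_comm, cget_expandAt_add_two hi (by omega) (by omega),
      cget_expandAt_add_two hi (by omega) (by omega)]

lemma break_pred_expandAt {v : List Letter} {i j : ℕ} (hi : i < v.length) (hj : j < v.length) :
    Break (expandAt v i) (shiftPos i j + (expandAt v i).length - 1) ↔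
      Break v (j + v.length - 1) := by
  have hlen := length_expandAt v i
  unfold shiftPos
  rcases Nat.eq_zero_or_pos j with rfl | hj0
  · rw [if_pos (Nat.zero_le _), hlen, ← break_expandAt_add_two (k := 0 + v.length - 1) hi
      (by omega) (by omega)]
    congr! 1
    omega
  have e : j + v.length - 1 = j - 1 + v.length := by omega
  split_ifs with h
  · rw [show j + (expandAt v i).length - 1 = j - 1 + (expandAt v i).length by omega, e,
      break_add_length, break_add_length, break_expandAt_of_lt hi (by omega)]
  · rw [show j + 2 + (expandAt v i).length - 1 = j - 1 + 2 + (expandAt v i).length by omega, e,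
      break_add_length, break_add_length, break_expandAt_add_two hi (by omega) (by omega)]

/-- Up to the next break, the breaks after `j` persist under expansion. -/
lemma break_succ_expandAt {v : List Letter} {i j k : ℕ} (hi : i < v.length)
    (hk : if j < i then j + k < i else j + k < i + v.length) :
    Break (expandAt v i) (shiftPos i j + gain i j + k) ↔ Break v (j + k) := by
  unfold shiftPos gain
  rcases lt_trichotomy j i with h | rfl | h
  · rw [if_pos h] at hk
    rw [if_pos h.le, if_neg h.ne, add_zero, break_expandAt_of_lt hi hk]
  · rw [if_neg (lt_irrefl _)] at hk
    rw [if_pos le_rfl, if_pos rfl, add_right_comm, break_expandAt_add_two hi (by omega) (by omega)]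
  · rw [if_neg (by omega)] at hk
    rw [if_neg (by omega), if_neg (by omega), add_zero, add_right_comm,
      break_expandAt_add_two hi (by omega) (by omega)]

lemma RunAt.break_pred {v : List Letter} (hv : CyclRed v) {i l : ℕ} (h : RunAt v i l) :
    Break v (i + v.length - 1) := by
  obtain ⟨m, rfl⟩ := h.exists_eq
  exact ((runAt_iff hv).1 h).2.2.2

lemma RunAt.break_pred_of_pos {v : List Letter} (hv : CyclRed v) {i l : ℕ} (h : RunAt v i l)
    (hi : 0 < i) : Break v (i - 1) := by
  have := h.break_pred hv
  rwa [show i + v.length - 1 = i - 1 + v.length by omega, break_add_length] at this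

/-- Expanding at a run `i` turns every run `j` into a run, longer by two letters if `j = i`. -/
lemma RunAt.expandAt {v : List Letter} (hv : CyclRed v) {i l₀ j l : ℕ} (h₀ : RunAt v i l₀)
    (h : RunAt v j l) : RunAt (expandAt v i) (shiftPos i j) (l + gain i j) := by
  have hi := h₀.1
  have hlen := length_expandAt v i
  obtain ⟨m, rfl⟩ := h.exists_eq
  obtain ⟨hj, hno, hbr, hbl⟩ := (runAt_iff hv).1 h
  have hbound : if j < i then j + m < i else j + m < i + v.length := by
    split_ifs with hji
    · by_contra! hle
      refine hno (i - 1 - j) (by omega) ?_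
      rw [show j + (i - 1 - j) = i - 1 by omega]
      exact h₀.break_pred_of_pos hv (by omega)
    · by_contra! hle
      refine hno (i + v.length - 1 - j) (by omega) ?_
      rw [show j + (i + v.length - 1 - j) = i + v.length - 1 by omega]
      exact h₀.break_pred hv
  rw [add_right_comm, runAt_iff (hv.expandAt hi)]
  refine ⟨?_, fun k hk => ?_, ?_, (break_pred_expandAt hi hj).2 hbl⟩
  · unfold shiftPos
    split_ifs <;> omega
  · rcases lt_or_ge k (gain i j) with hg | hg
    · obtain rfl : j = i := by
        by_contra hne
        simp [gain, hne] at hg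
      simp only [gain, if_true, shiftPos, le_refl] at hg ⊢
      exact not_break_expandAt hi (by omega) (by omega)
    · obtain ⟨k, rfl⟩ := Nat.exists_eq_add_of_le hg
      rw [← add_assoc, break_succ_expandAt hi (by split_ifs at hbound ⊢ <;> omega)]
      exact hno k (by omega)
  · rw [add_comm m, ← add_assoc, break_succ_expandAt hi hbound]
    exact hbr

/-- All runs of an expansion come from runs of the original word. -/
lemma RunAt.exists_of_expandAt {v : List Letter} (hv : CyclRed v) {i l₀ j' l' : ℕ}
    (h₀ : RunAt v i l₀) (h : RunAt (_root_.expandAt v i) j' l') :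
    ∃ j l, RunAt v j l ∧ j' = shiftPos i j ∧ l' = l + gain i j := by
  have hi := h₀.1
  have hlen := length_expandAt v i
  obtain ⟨m', rfl⟩ := h.exists_eq
  obtain ⟨hj', hno, hbr, hbl⟩ := (runAt_iff (hv.expandAt hi)).1 h
  obtain ⟨j, hj, rfl⟩ : ∃ j < v.length, j' = shiftPos i j := by
    rcases le_or_gt j' i with hle | hlt
    · exact ⟨j', by omega, by simp [shiftPos, hle]⟩
    · have hge : i + 2 < j' := by
        by_contra! hle
        refine not_break_expandAt hi (k := j' - 1) (by omega) (by omega) ?_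
        exact h.break_pred_of_pos (hv.expandAt hi) (by omega)
      exact ⟨j' - 2, by omega, by rw [shiftPos, if_neg (by omega)]; omega⟩
  obtain ⟨m, rfl⟩ : ∃ m, m' = gain i j + m := by
    refine Nat.exists_eq_add_of_le ?_
    by_contra! hlt
    obtain rfl : j = i := by
      by_contra hne
      simp [gain, hne] at hlt
    simp only [gain, if_true, shiftPos, le_refl] at hlt hbr
    exact not_break_expandAt hi (by omega) (by omega) hbr
  have hbound : if j < i then j + m < i else j + m < i + v.length := by
    split_ifs with hji
    · by_contra! hle
      refine hno (gain i j + (i - 1 - j)) (by omega) ?_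
      rw [← add_assoc, break_succ_expandAt hi (by rw [if_pos hji]; omega),
        show j + (i - 1 - j) = i - 1 by omega]
      exact h₀.break_pred_of_pos hv (by omega)
    · by_contra! hle
      refine hno (gain i j + (i + v.length - 1 - j)) (by omega) ?_
      rw [← add_assoc, break_succ_expandAt hi (by rw [if_neg hji]; omega),
        show j + (i + v.length - 1 - j) = i + v.length - 1 by omega]
      exact h₀.break_pred hv
  refine ⟨j, m + 2, (runAt_iff hv).2 ⟨hj, fun k hk => ?_, ?_, (break_pred_expandAt hi hj).1 hbl⟩,
    rfl, by omega⟩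
  · rw [← break_succ_expandAt hi (by split_ifs at hbound ⊢ <;> omega), add_assoc]
    exact hno _ (by omega)
  · rw [← break_succ_expandAt hi hbound, add_assoc]
    exact hbr

lemma DistinguishedRun.expandAt {v : List Letter} (hv : CyclRed v) {i l₀ j l : ℕ}
    (h₀ : DistinguishedRun v i l₀) (h : DistinguishedRun v j l) :
    DistinguishedRun (expandAt v i) (shiftPos i j) (l + gain i j) := by
  refine ⟨h₀.1.expandAt hv h.1, fun j₂' l₂' hr ht hne => ?_⟩
  obtain ⟨j₂, l₂, hr₂, rfl, rfl⟩ := h₀.1.exists_of_expandAt hv hr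
  rw [runType_expandAt h₀.1.1 hr₂.1, runType_expandAt h₀.1.1 h.1.1] at ht
  have hne₂ : j₂ ≠ j := fun e => hne (by rw [e])
  have hlt := h.2 j₂ l₂ hr₂ ht hne₂
  by_cases hji : j₂ = i
  · subst hji
    obtain rfl := hr₂.length_unique h₀.1
    exact absurd (h₀.2 j l h.1 ht.symm hne₂.symm) hlt.asymm
  · simp only [gain, if_neg hji]
    omega

lemma DistinguishedRun.exists_of_expandAt {v : List Letter} (hv : CyclRed v) {i l₀ j' l' : ℕ}
    (h₀ : DistinguishedRun v i l₀) (h : DistinguishedRun (_root_.expandAt v i) j' l') :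
    ∃ j l, DistinguishedRun v j l ∧ j' = shiftPos i j ∧ l' = l + gain i j := by
  obtain ⟨j, l, hr, rfl, rfl⟩ := h₀.1.exists_of_expandAt hv h.1
  refine ⟨j, l, ?_, rfl, rfl⟩
  by_cases hji : j = i
  · subst hji
    obtain rfl := hr.length_unique h₀.1
    exact h₀
  · refine ⟨hr, fun j₂ l₂ hr₂ ht hne => ?_⟩
    have := h.2 _ _ (h₀.1.expandAt hv hr₂)
      (by rw [runType_expandAt h₀.1.1 hr₂.1, runType_expandAt h₀.1.1 hr.1, ht])
      ((shiftPos_injective i).ne hne)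
    simp only [gain, if_neg hji] at this
    omega

/-- A distinguished run is the only run of its type that is distinguished. -/
lemma DistinguishedRun.unique {v : List Letter} {i l j l₂ : ℕ} (h : DistinguishedRun v i l)
    (h₂ : DistinguishedRun v j l₂) (ht : runType v i = runType v j) : i = j ∧ l = l₂ := by
  obtain rfl : i = j := by
    by_contra hne
    exact (h.2 j l₂ h₂.1 ht.symm (Ne.symm hne)).asymm (h₂.2 i l h.1 ht hne)
  exact ⟨rfl, h.1.length_unique h₂.1⟩

/-- Some cyclic interval of `N` letters of `w` lies in `T`. -/
def HasInterval (w : List Letter) (T : Finset Letter) (N : ℕ) : Prop :=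
  ∃ i, ∀ j < N, cget w (i + j) ∈ T

lemma runAt_of_maximal {w : List Letter} (hw : CyclRed w) {T : Finset Letter} (hT : T.card = 2)
    {a N : ℕ} (hN : 2 ≤ N) (h : ∀ j < N, cget w (a + j) ∈ T) (hmax : ¬ HasInterval w T (N + 1)) :
    RunAt w (a % w.length) N ∧ runType w (a % w.length) = T := by
  have hn := List.length_pos_iff.2 hw.1
  have h' : ∀ j, cget w (a % w.length + j) = cget w (a + j) := fun j => by
    rw [← cget_mod, Nat.mod_add_mod, cget_mod]
  have htype := hw.runType_eq hT hN (i := a % w.length) (by simpa only [h'] using h)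
  refine ⟨⟨Nat.mod_lt _ hn, hN, ?_, ⟨T, hT, by simpa only [h'] using h⟩, ?_, ?_⟩, htype⟩
  · by_contra! hle
    exact hmax ⟨0, fun j _ => forall_cget_mem hw.1 (fun j hj => h j (by omega)) _⟩
  · rintro ⟨S, hS, hin⟩
    obtain rfl : T = S := htype.symm.trans (hw.runType_eq hS hN fun j hj => hin j (by omega))
    exact hmax ⟨_, hin⟩
  · rintro ⟨S, hS, hin⟩
    obtain rfl : T = S := by
      refine htype.symm.trans (hw.runType_eq hS hN fun j hj => ?_)
      have := hin (j + 1) (by omega)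
      rwa [show a % w.length + w.length - 1 + (j + 1) = a % w.length + j + w.length by omega,
        cget_add_length] at this
    exact hmax ⟨_, hin⟩

/-- The length of a distinguished run is the maximal length of an interval in its type. -/
lemma DistinguishedRun.hasInterval_iff {w : List Letter} (hw : CyclRed w) {i l : ℕ}
    (h : DistinguishedRun w i l) (N : ℕ) : HasInterval w (runType w i) N ↔ N ≤ l := by
  obtain ⟨hi, hl, hlt, ⟨T, hT, hin⟩, hright, hleft⟩ := id h.1
  obtain rfl := hw.runType_eq hT hl hin
  refine ⟨fun hN => ?_, fun hN => ⟨i, fun j hj => hin j (by omega)⟩⟩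
  have hbound : ∀ M, HasInterval w (runType w i) M → M < w.length := by
    rintro M ⟨a, ha⟩
    by_contra! hle
    exact hright ⟨_, hT, fun j _ => forall_cget_mem hw.1 (fun j hj => ha j (by omega)) _⟩
  by_contra! hlN
  let P := fun M => HasInterval w (runType w i) M
  have hP := Nat.findGreatest_spec (P := P) (hbound N hN).le hN
  have hge := Nat.le_findGreatest (P := P) (hbound N hN).le hN
  set M := Nat.findGreatest P w.length with hM
  have hmax : ¬ P (M + 1) := fun hc => by
    have := Nat.le_findGreatest (P := P) (hbound _ hc).le hc
    omega
  obtain ⟨a, ha⟩ := hP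
  obtain ⟨hr, ht⟩ := runAt_of_maximal hw hT (by omega) ha hmax
  by_cases e : a % w.length = i
  · rw [e] at hr
    have := hr.length_unique h.1
    omega
  · have := h.2 _ _ hr ht e
    omega

lemma cget_rotate (w : List Letter) (k j : ℕ) : cget (w.rotate k) j = cget w (j + k) := by
  rcases Nat.eq_zero_or_pos w.length with h | h
  · simp [List.length_eq_zero_iff.1 h, cget]
  · simp [cget, List.getD_eq_getElem?_getD, List.getElem?_rotate (Nat.mod_lt j h)]

lemma cget_reverse {w : List Letter} {j : ℕ} (hj : j < w.length) :
    cget w.reverse j = cget w (w.length - 1 - j) := by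
  rw [cget_eq_getD (by simpa using hj), cget_eq_getD (by omega)]
  simp [List.getD_eq_getElem?_getD, List.getElem?_reverse hj]

lemma HasInterval.rotate {w : List Letter} {T : Finset Letter} {N : ℕ} (h : HasInterval w T N)
    (k : ℕ) : HasInterval (w.rotate k) T N := by
  obtain ⟨i, hi⟩ := h
  rcases Nat.eq_zero_or_pos w.length with hn | hn
  · rw [List.length_eq_zero_iff.1 hn] at hi ⊢
    exact ⟨i, by simpa using hi⟩
  refine ⟨i + (k * w.length - k), fun j hj => ?_⟩
  have hk : k ≤ k * w.length := Nat.le_mul_of_pos_right k hn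
  rw [cget_rotate, show i + (k * w.length - k) + j + k = i + j + k * w.length by omega,
    ← cget_mod, Nat.add_mul_mod_self_right, cget_mod]
  exact hi j hj

lemma HasInterval.reverse {w : List Letter} {T : Finset Letter} {N : ℕ} (h : HasInterval w T N) :
    HasInterval w.reverse T N := by
  obtain ⟨i, hi⟩ := h
  rcases Nat.eq_zero_or_pos w.length with hn | hn
  · rw [List.length_eq_zero_iff.1 hn] at hi ⊢
    exact ⟨i, by simpa using hi⟩
  refine ⟨(i + N) * w.length - (i + N), fun j hj => ?_⟩
  have hk : i + N ≤ (i + N) * w.length := Nat.le_mul_of_pos_right _ hn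
  rw [← cget_mod, cget_reverse (by simpa using Nat.mod_lt _ hn), List.length_reverse]
  have := hi (N - 1 - j) (by omega)
  rw [← cget_mod] at this
  convert this using 1
  set r := ((i + N) * w.length - (i + N) + j) % w.length with hr
  have hrlt : r < w.length := Nat.mod_lt _ hn
  rw [cget_mod, ← cget_mod w (w.length - 1 - r), ← cget_mod w (i + _)]
  congr 1
  refine Nat.ModEq.add_right_cancel' (r + 1) ?_
  rw [show w.length - 1 - r + (r + 1) = w.length by omega]
  have : (i + (N - 1 - j) + (r + 1)) ≡ (i + N) * w.length [MOD w.length] := by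
    have h1 : r ≡ (i + N) * w.length - (i + N) + j [MOD w.length] := Nat.mod_modEq _ _
    have := (h1.add_right 1).add_left (i + (N - 1 - j))
    rwa [show i + (N - 1 - j) + ((i + N) * w.length - (i + N) + j + 1) = (i + N) * w.length by
      omega] at this
  exact (this.trans (by simp [Nat.ModEq])).symm

lemma hasInterval_rotate {w : List Letter} {T : Finset Letter} {N : ℕ} (k : ℕ) :
    HasInterval (w.rotate k) T N ↔ HasInterval w T N :=
  ⟨fun ⟨i, hi⟩ => ⟨i + k, fun j hj => by
    rw [add_right_comm, ← cget_rotate]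
    exact hi j hj⟩, fun h => h.rotate k⟩

lemma hasInterval_reverse {w : List Letter} {T : Finset Letter} {N : ℕ} :
    HasInterval w.reverse T N ↔ HasInterval w T N :=
  ⟨fun h => by simpa using h.reverse, fun h => h.reverse⟩

lemma WordEquiv.hasInterval_iff {u v : List Letter} (h : WordEquiv u v) (T : Finset Letter)
    (N : ℕ) : HasInterval u T N ↔ HasInterval v T N := by
  obtain ⟨k, -, rfl | rfl⟩ := h
  · rw [hasInterval_rotate]
  · rw [hasInterval_rotate, hasInterval_reverse]

lemma hasInterval_iff_of_mk_eq {u v : GWord} (h : Quot.mk GEquiv u = Quot.mk GEquiv v)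
    (T : Finset Letter) (N : ℕ) : HasInterval u.1 T N ↔ HasInterval v.1 T N :=
  (congrArg (Quot.lift (fun u : GWord => HasInterval u.1 T N)
    fun _ _ h => propext (WordEquiv.hasInterval_iff h T N)) h).to_iff

lemma rotate_flatten_replicate {α : Type*} (u : List α) (k : ℕ) :
    (List.replicate k u).flatten.rotate u.length = (List.replicate k u).flatten := by
  cases k with
  | zero => simp
  | succ k =>
    conv_rhs => rw [List.replicate_succ']
    rw [List.replicate_succ, List.flatten_cons, List.rotate_append_length_eq]
    simp

lemma DistinguishedRun.primitive {w : List Letter} (hw : CyclRed w) {i l : ℕ}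
    (h : DistinguishedRun w i l) : Primitive w := by
  rintro ⟨u, k, -, hlt, j, hj⟩
  have hn := List.length_pos_iff.2 hw.1
  have hu : 0 < u.length := by
    by_contra! h0
    have := congrArg List.length hj
    simp only [List.length_rotate, List.length_flatten, List.map_replicate, List.sum_replicate,
      smul_eq_mul, Nat.le_zero.1 h0, mul_zero] at this
    omega
  have hrot : w.rotate u.length = w := by
    apply List.rotate_injective j
    change (w.rotate u.length).rotate j = w.rotate j
    rw [List.rotate_rotate, add_comm, ← List.rotate_rotate, hj, rotate_flatten_replicate]
  have hper : ∀ m, cget w ((i + u.length) % w.length + m) = cget w (i + m) := fun m => by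
    rw [← cget_mod, Nat.mod_add_mod, cget_mod, add_right_comm, ← cget_rotate, hrot]
  have hperB : ∀ m, Break w ((i + u.length) % w.length + m) ↔ Break w (i + m) := fun m => by
    rw [Break, Break, add_assoc, add_assoc, hper, hper]
  have hi := h.1.1
  have hne : (i + u.length) % w.length ≠ i := by
    rcases lt_or_ge (i + u.length) w.length with hc | hc
    · rw [Nat.mod_eq_of_lt hc]
      omega
    · rw [Nat.mod_eq_sub_mod hc, Nat.mod_eq_of_lt (by omega)]
      omega
  obtain ⟨m, rfl⟩ := h.1.exists_eq
  obtain ⟨-, hno, hbr, hbl⟩ := (runAt_iff hw).1 h.1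
  refine (h.2 _ _ ((runAt_iff hw).2 ⟨Nat.mod_lt _ hn, fun k hk => ?_, ?_, ?_⟩) ?_ hne).false
  · rw [hperB]
    exact hno k hk
  · rwa [hperB]
  · rw [Nat.add_sub_assoc hn] at hbl ⊢
    rwa [hperB]
  · have h0 := hper 0
    simp only [add_zero] at h0
    rw [runType, runType, h0, hper]

lemma InG.expandAt {v : List Letter} (hv : InG v) {i l : ℕ} (h : DistinguishedRun v i l) :
    InG (expandAt v i) := by
  have hlen := length_expandAt v i
  refine ⟨hv.1.expandAt h.1.1, (h.expandAt hv.1 h).primitive (hv.1.expandAt h.1.1), ?_, ?_⟩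
  · have := hv.2.2.1
    omega
  · have := hv.2.2.2
    omega

lemma expandAt_comm {v : List Letter} {i j : ℕ} (hij : i < j) (hj : j < v.length) :
    expandAt (expandAt v i) (j + 2) = expandAt (expandAt v j) i := by
  have hi := hij.trans hj
  have h1 : cget (expandAt v i) (j + 2) = cget v j :=
    cget_expandAt_add_two hi hij.le (by omega)
  have h2 : cget (expandAt v i) (j + 2 + 1) = cget v (j + 1) := by
    rw [add_right_comm]
    exact cget_expandAt_add_two hi (by omega) (by omega)
  have h3 : cget (expandAt v j) i = cget v i := cget_expandAt_of_le hj (by omega)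
  have h4 : cget (expandAt v j) (i + 1) = cget v (i + 1) := cget_expandAt_of_le hj (by omega)
  obtain ⟨A, B, C, rfl, rfl, rfl⟩ :
      ∃ A B C : List Letter, v = A ++ B ++ C ∧ i = A.length ∧ j = (A ++ B).length :=
    ⟨v.take i, (v.take j).drop i, v.drop j, by
      have := List.take_append_drop i (v.take j)
      rw [List.take_take, min_eq_left hij.le] at this
      rw [this, List.take_append_drop], by simp [hi.le], by simp; omega⟩
  rw [expandAt, h1, h2, expandAt, expandAt, h3, h4, expandAt]
  generalize cget (A ++ B ++ C) _ = a
  generalize cget (A ++ B ++ C) _ = b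
  generalize cget (A ++ B ++ C) _ = c
  generalize cget (A ++ B ++ C) _ = d
  have e : (A ++ B).length + 2 = (A ++ [a, b] ++ B).length := by
    simp only [List.length_append, List.length_cons, List.length_nil]
    omega
  have e' : A ++ [a, b] ++ (B ++ C) = (A ++ [a, b] ++ B) ++ C := by simp
  rw [List.append_assoc A B C, List.take_left, List.drop_left, e', e, List.take_left,
    List.drop_left, ← List.append_assoc A B C, List.take_left, List.drop_left]
  simp

/-- `v` has a distinguished run of type `T`. -/
def HasDistinguished (T : Finset Letter) (v : GWord) : Prop :=
  ∃ i l, DistinguishedRun v.1 i l ∧ runType v.1 i = T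

/-- Expansion at the distinguished run of type `T`, if there is one. -/
noncomputable def expandType (T : Finset Letter) (v : GWord) : GWord :=
  if h : HasDistinguished T v then
    ⟨expandAt v.1 h.choose, v.2.expandAt h.choose_spec.choose_spec.1⟩
  else v

lemma expandType_val {T : Finset Letter} {v : GWord} {i l : ℕ} (h : DistinguishedRun v.1 i l)
    (ht : runType v.1 i = T) : (expandType T v).1 = expandAt v.1 i := by
  have hT : HasDistinguished T v := ⟨i, l, h, ht⟩
  obtain ⟨h', ht'⟩ := hT.choose_spec.choose_spec
  exact (congrArg Subtype.val (dif_pos hT)).trans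
    (congrArg (expandAt v.1) (h'.unique h (ht'.trans ht.symm)).1)

lemma expandType_of_not {T : Finset Letter} {v : GWord} (h : ¬ HasDistinguished T v) :
    expandType T v = v := dif_neg h

lemma DistinguishedRun.expandType {v : GWord} {j l : ℕ} (h : DistinguishedRun v.1 j l)
    {T : Finset Letter} (hT : HasDistinguished T v) :
    ∃ j', DistinguishedRun (expandType T v).1 j' (l + 2 * if runType v.1 j = T then 1 else 0) ∧
      runType (_root_.expandType T v).1 j' = runType v.1 j := by
  obtain ⟨i, l₀, h₀, rfl⟩ := hT
  refine ⟨shiftPos i j, ?_, ?_⟩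
  · rw [expandType_val h₀ rfl]
    convert h₀.expandAt v.2.1 h using 2
    by_cases hji : j = i
    · simp [gain, hji]
    · have : runType v.1 j ≠ runType v.1 i := fun e => hji (h.unique h₀ e).1
      simp [gain, hji, this]
  · rw [expandType_val h₀ rfl, runType_expandAt h₀.1.1 h.1.1]

lemma hasDistinguished_expandType {S T : Finset Letter} {v : GWord} :
    HasDistinguished S (expandType T v) ↔ HasDistinguished S v := by
  by_cases hT : HasDistinguished T v
  · constructor
    · rintro ⟨j', l', h, rfl⟩
      obtain ⟨i, l₀, h₀, rfl⟩ := hT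
      rw [expandType_val h₀ rfl] at h ⊢
      obtain ⟨j, l, hj, rfl, rfl⟩ := h₀.exists_of_expandAt v.2.1 h
      exact ⟨j, l, hj, (runType_expandAt h₀.1.1 hj.1.1).symm⟩
    · rintro ⟨j, l, h, rfl⟩
      obtain ⟨j', h', ht'⟩ := h.expandType hT
      exact ⟨j', _, h', ht'⟩
  · rw [expandType_of_not hT]

lemma expandType_comm_of_lt {v : GWord} {i j l l' : ℕ} (hi : DistinguishedRun v.1 i l)
    (hj : DistinguishedRun v.1 j l') (hij : i < j) :
    expandType (runType v.1 j) (expandType (runType v.1 i) v) =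
      expandType (runType v.1 i) (expandType (runType v.1 j) v) := by
  have ei := expandType_val hi rfl
  have ej := expandType_val hj rfl
  have hj' := hi.expandAt v.2.1 hj
  have hi' := hj.expandAt v.2.1 hi
  have htj := runType_expandAt hi.1.1 hj.1.1
  have hti := runType_expandAt hj.1.1 hi.1.1
  rw [← ei] at hj' htj
  rw [← ej] at hi' hti
  apply Subtype.ext
  rw [expandType_val hj' htj, expandType_val hi' hti, ei, ej, shiftPos, if_neg (by omega), shiftPos,
    if_pos hij.le, expandAt_comm hij hj.1.1]

instance : LeftCommutative expandType where
  left_comm S T v := by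
    by_cases hS : HasDistinguished S v
    · by_cases hT : HasDistinguished T v
      · obtain ⟨i, l, hi, rfl⟩ := hS
        obtain ⟨j, l', hj, rfl⟩ := hT
        rcases lt_trichotomy i j with h | rfl | h
        · exact (expandType_comm_of_lt hi hj h).symm
        · rfl
        · exact expandType_comm_of_lt hj hi h
      · rw [expandType_of_not hT]
        exact (expandType_of_not (by rwa [hasDistinguished_expandType])).symm
    · rw [expandType_of_not hS]
      exact expandType_of_not (by rwa [hasDistinguished_expandType])

/-- The descendant of `w` obtained by expanding at the distinguished runs of the types in `s`,
with multiplicity. -/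
noncomputable def descend (w : GWord) (s : Multiset (Finset Letter)) : GWord :=
  s.foldr expandType w

@[simp] lemma descend_zero (w : GWord) : descend w 0 = w := rfl

@[simp] lemma descend_cons (w : GWord) (T : Finset Letter) (s : Multiset (Finset Letter)) :
    descend w (T ::ₘ s) = expandType T (descend w s) := Multiset.foldr_cons ..

lemma hasDistinguished_descend {S : Finset Letter} {w : GWord} {s : Multiset (Finset Letter)} :
    HasDistinguished S (descend w s) ↔ HasDistinguished S w := by
  induction s using Multiset.induction with
  | empty => rfl
  | cons T s ih => rw [descend_cons, hasDistinguished_expandType, ih]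

lemma DistinguishedRun.descend {w : GWord} {i l : ℕ} (h : DistinguishedRun w.1 i l)
    (s : Multiset (Finset Letter)) :
    ∃ i', DistinguishedRun (descend w s).1 i' (l + 2 * s.count (runType w.1 i)) ∧
      runType (_root_.descend w s).1 i' = runType w.1 i := by
  induction s using Multiset.induction with
  | empty => exact ⟨i, h, rfl⟩
  | cons T s ih =>
    obtain ⟨j, hj, ht⟩ := ih
    by_cases hT : HasDistinguished T (_root_.descend w s)
    · obtain ⟨j', hj', ht'⟩ := hj.expandType hT
      rw [descend_cons]
      refine ⟨j', ?_, ht'.trans ht⟩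
      rw [ht] at hj'
      rwa [Multiset.count_cons, mul_add, ← add_assoc]
    · have hne : runType w.1 i ≠ T := by
        rintro rfl
        exact hT ⟨j, _, hj, ht⟩
      rw [descend_cons, expandType_of_not hT, Multiset.count_cons_of_ne hne]
      exact ⟨j, hj, ht⟩

lemma count_eq_of_mk_descend_eq {w : GWord} {s t : Multiset (Finset Letter)}
    (h : Quot.mk GEquiv (descend w s) = Quot.mk GEquiv (descend w t)) {T : Finset Letter}
    (hT : HasDistinguished T w) : s.count T = t.count T := by
  obtain ⟨i, l, hi, rfl⟩ := hT
  obtain ⟨j, hj, htj⟩ := hi.descend s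
  obtain ⟨k, hk, htk⟩ := hi.descend t
  have key : ∀ N, N ≤ l + 2 * s.count (runType w.1 i) ↔ N ≤ l + 2 * t.count (runType w.1 i) := by
    intro N
    rw [← hj.hasInterval_iff (descend w s).2.1, ← hk.hasInterval_iff (descend w t).2.1, htj, htk]
    exact hasInterval_iff_of_mk_eq h _ N
  have := (key _).1 le_rfl
  have := (key _).2 le_rfl
  omega

lemma Lw_descend {w : GWord} {s : Multiset (Finset Letter)}
    (hs : ∀ T ∈ s, HasDistinguished T w) :
    Lw (descend w s).1 = Lw w.1 + s.card := by
  induction s using Multiset.induction with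
  | empty => simp
  | cons T s ih =>
    obtain ⟨i, l, hi, ht⟩ := hasDistinguished_descend (s := s).2 (hs T (by simp))
    have := ih fun S hS => hs S (by simp [hS])
    rw [descend_cons, expandType_val hi ht, Multiset.card_cons]
    rw [Lw] at this ⊢
    rw [length_expandAt]
    push_cast
    omega

lemma desc_iff {w : GWord} {v : List Letter} :
    Desc w.1 v ↔ ∃ s : Multiset (Finset Letter), (∀ T ∈ s, HasDistinguished T w) ∧
      (descend w s).1 = v := by
  constructor
  · intro h
    induction h with
    | base => exact ⟨0, by simp, rfl⟩
    | step v i l _ hd ih =>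
      obtain ⟨s, hs, rfl⟩ := ih
      refine ⟨runType (descend w s).1 i ::ₘ s, ?_, by rw [descend_cons, expandType_val hd rfl]⟩
      intro T hT
      rcases Multiset.mem_cons.1 hT with rfl | hT
      · exact hasDistinguished_descend.1 ⟨i, l, hd, rfl⟩
      · exact hs T hT
  · rintro ⟨s, hs, rfl⟩
    induction s using Multiset.induction with
    | empty => exact Desc.base
    | cons T s ih =>
      obtain ⟨i, l, hi, ht⟩ := hasDistinguished_descend (s := s).2 (hs T (by simp))
      rw [descend_cons, expandType_val hi ht]
      exact Desc.step _ i l (ih fun S hS => hs S (by simp [hS])) hi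

lemma rank_eq_card (w : GWord) : rank w.1 = Nat.card {T // HasDistinguished T w} := by
  refine Nat.card_congr (Equiv.ofBijective
    (fun p => ⟨runType w.1 p.1.1, p.1.1, p.1.2, p.2, rfl⟩) ⟨?_, ?_⟩)
  · rintro ⟨⟨i, l⟩, h⟩ ⟨⟨j, l'⟩, h'⟩ e
    obtain ⟨rfl, rfl⟩ := h.unique h' (congrArg Subtype.val e)
    rfl
  · rintro ⟨T, i, l, h, rfl⟩
    exact ⟨⟨(i, l), h⟩, rfl⟩

instance : Finite Letter :=
  Set.finite_univ_iff.1 (Set.Finite.subset (Set.toFinite {Letter.x, Letter.y, Letter.z})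
    fun a _ => by cases a <;> simp)

/-- The classes of descendants of `w` with `n` expansions correspond to the multisets of `n` types
of distinguished runs. -/
lemma card_descendants (w : GWord) (n : ℕ) :
    Nat.card {c : GClass // ∃ v : GWord, Desc w.1 v.1 ∧ Quot.mk GEquiv v = c ∧
      Lw v.1 = Lw w.1 + n} = (rank w.1).multichoose n := by
  have := Fintype.ofFinite {T // HasDistinguished T w}
  rw [rank_eq_card, Nat.card_eq_fintype_card (α := {T // HasDistinguished T w}), ← Sym.card_sym_eq_multichoose,
    ← Nat.card_eq_fintype_card]
  have hmem (s : Multiset {T // HasDistinguished T w}) :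
      ∀ T ∈ s.map Subtype.val, HasDistinguished T w := by
    intro T hT
    obtain ⟨S, -, rfl⟩ := Multiset.mem_map.1 hT
    exact S.2
  symm
  refine Nat.card_congr (Equiv.ofBijective
    (fun s => ⟨Quot.mk GEquiv (descend w (s.1.map Subtype.val)), _,
      desc_iff.2 ⟨_, hmem s.1, rfl⟩, rfl, ?_⟩) ⟨fun s t h => ?_, ?_⟩)
  · rw [Lw_descend (hmem s.1), Multiset.card_map, s.2]
  · apply Subtype.ext
    apply Multiset.map_injective Subtype.val_injective
    ext T
    by_cases hT : HasDistinguished T w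
    · exact count_eq_of_mk_descend_eq (congrArg Subtype.val h) hT
    · rw [Multiset.count_eq_zero_of_notMem fun h => hT (hmem _ T h),
        Multiset.count_eq_zero_of_notMem fun h => hT (hmem _ T h)]
  · rintro ⟨_, v, hv, rfl, hL⟩
    obtain ⟨s, hs, hsv⟩ := desc_iff.1 hv
    obtain rfl : descend w s = v := Subtype.ext hsv
    lift s to Multiset {T // HasDistinguished T w} using hs
    rw [Lw_descend (hmem s), Multiset.card_map] at hL
    exact ⟨⟨s, by omega⟩, rfl⟩

lemma Lw_le_of_desc {w : GWord} {v : List Letter} (h : Desc w.1 v) : Lw w.1 ≤ Lw v := by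
  obtain ⟨s, hs, rfl⟩ := desc_iff.1 h
  rw [Lw_descend hs]
  omega

lemma binC_add_sub_one (r n : ℕ) : binC (n + r - 1) (r - 1) = r.multichoose n := by
  rw [Nat.multichoose_eq]
  cases r with
  | zero =>
    cases n with
    | zero => simp [binC]
    | succ n =>
      rw [Nat.choose_eq_zero_of_lt (by omega), binC, if_neg (by omega), if_neg (by omega)]
      rfl
  | succ r =>
    rw [binC, if_neg (by omega), if_pos (by omega)]
    rw [show ((n : ℤ) + (r + 1 : ℕ) - 1).toNat = n + r by omega,
      show (((r + 1 : ℕ) : ℤ) - 1).toNat = r by omega, show r + 1 + n - 1 = n + r by omega,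
      Nat.choose_symm_add]

lemma binC_of_neg (r : ℕ) {n : ℤ} (hn : n < 0) : binC (n + r - 1) (r - 1) = 0 := by
  rw [binC, if_neg (by omega)]
  split_ifs with h
  · rw [Nat.choose_eq_zero_of_lt (by omega)]
    rfl
  · rfl

theorem almost_simple_geodesics_stmt7 (w : List Letter) (hw : InG w) (L : ℤ) :
    (Nat.card {c : GClass // ∃ v : GWord, Desc w v.1 ∧ Quot.mk GEquiv v = c ∧ Lw v.1 = L} : ℤ)
      = binC (L - Lw w + (rank w : ℤ) - 1) ((rank w : ℤ) - 1) := by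
  rcases lt_or_ge L (Lw w) with hL | hL
  · rw [binC_of_neg _ (by omega)]
    rw [Nat.cast_eq_zero, Nat.card_eq_zero]
    refine Or.inl ⟨fun ⟨_, v, hv, _, hvL⟩ => ?_⟩
    have := Lw_le_of_desc (w := ⟨w, hw⟩) hv
    simp only at this
    omega
  · obtain ⟨n, rfl⟩ := Int.le.dest hL
    rw [add_sub_cancel_left, binC_add_sub_one]
    exact congrArg _ (card_descendants ⟨w, hw⟩ n)
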